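/- arXiv:1904.03467 — 2 statements merged into one kernel-verified Lean document; each statement's English description precedes it below -/
import Mathlib

section
/- Let B_x ⊊ B_y be two locally-dense subgraphs of G in the chain ∅ = B_0 ⊊ ⋯ ⊊ B_k = V. Set α = d(B_y, B_x) + |V|^{-2} and let B_z be the largest maximizer of W ↦ |E(W)| − α|W|. If y > x+1 then x < z < y; if y = x+1 then z = x. -/
open Finset

variable {V : Type*}

/-- Edges of `G` with both endpoints in `X`. -/
def innerEdges [Fintype V] [DecidableEq V] (G : SimpleGraph V) [DecidableRel G.Adj]
    (X : Finset V) : Finset (Sym2 V) :=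
  G.edgeFinset.filter (fun e => ∀ v ∈ e, v ∈ X)

/-- Marginal edges `Ẽ(X,Y) = E(X) ∪ E(X,Y)` (for disjoint `X`, `Y`):
edges with both endpoints in `X ∪ Y`, at least one in `X`. -/
def margEdges [Fintype V] [DecidableEq V] (G : SimpleGraph V) [DecidableRel G.Adj]
    (X Y : Finset V) : Finset (Sym2 V) :=
  G.edgeFinset.filter (fun e => (∀ v ∈ e, v ∈ X ∪ Y) ∧ ∃ v ∈ e, v ∈ X)

/-- Outer density `d(X,Y) = |Ẽ(X \ Y, Y)| / |X \ Y|`. -/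
def outDensity [Fintype V] [DecidableEq V] (G : SimpleGraph V) [DecidableRel G.Adj]
    (X Y : Finset V) : ℚ :=
  ((margEdges G (X \ Y) Y).card : ℚ) / ((X \ Y).card : ℚ)

/-- `W` is locally dense: there is no nonempty `X ⊆ W` and nonempty `Y` with `Y ∩ W = ∅`
such that `d(X, W \ X) ≤ d(Y, W)`. -/
def LocallyDense [Fintype V] [DecidableEq V] (G : SimpleGraph V) [DecidableRel G.Adj]
    (W : Finset V) : Prop :=
  ¬ ∃ X Y : Finset V, X.Nonempty ∧ Y.Nonempty ∧ X ⊆ W ∧ Y ∩ W = ∅ ∧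
      outDensity G X (W \ X) ≤ outDensity G Y W

/-- Number of neighbors of `x` in `U`. -/
def degIn [DecidableEq V] (G : SimpleGraph V) [DecidableRel G.Adj] (x : V) (U : Finset V) : ℕ :=
  (U.filter (G.Adj x)).card

theorem card_margEdges_sdiff [Fintype V] [DecidableEq V] (G : SimpleGraph V)
    [DecidableRel G.Adj] {X Y : Finset V} (h : Y ⊆ X) :
    (margEdges G (X \ Y) Y).card + (innerEdges G Y).card = (innerEdges G X).card := by
  have hdisj : Disjoint (margEdges G (X \ Y) Y) (innerEdges G Y) := by
    rw [Finset.disjoint_left]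
    intro e he he'
    simp only [margEdges, innerEdges, mem_filter] at he he'
    obtain ⟨v, hv, hvX⟩ := he.2.2
    exact (mem_sdiff.1 hvX).2 (he'.2 v hv)
  rw [← card_union_of_disjoint hdisj]
  congr 1
  ext e
  simp only [margEdges, innerEdges, mem_union, mem_filter, mem_sdiff]
  constructor
  · rintro (⟨he, h1, -⟩ | ⟨he, h1⟩)
    · exact ⟨he, fun v hv => (h1 v hv).elim And.left (@h v)⟩
    · exact ⟨he, fun v hv => h (h1 v hv)⟩
  · rintro ⟨he, h1⟩
    by_cases hY : ∀ v ∈ e, v ∈ Y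
    · exact Or.inr ⟨he, hY⟩
    · push Not at hY
      obtain ⟨v, hv, hvY⟩ := hY
      refine Or.inl ⟨he, fun u hu => ?_, v, hv, h1 v hv, hvY⟩
      by_cases huY : u ∈ Y
      · exact Or.inr huY
      · exact Or.inl ⟨h1 u hu, huY⟩

theorem outDensity_sdiff [Fintype V] [DecidableEq V] (G : SimpleGraph V)
    [DecidableRel G.Adj] (X Y : Finset V) : outDensity G (X \ Y) Y = outDensity G X Y := by
  simp [outDensity]

theorem outDensity_mul_card_sub [Fintype V] [DecidableEq V] (G : SimpleGraph V)
    [DecidableRel G.Adj] {X Y : Finset V} (h : Y ⊂ X) :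
    outDensity G X Y * ((X.card : ℚ) - Y.card) =
      ((innerEdges G X).card : ℚ) - (innerEdges G Y).card := by
  have h1 : ((X \ Y).card : ℚ) + Y.card = X.card := by
    exact_mod_cast card_sdiff_add_card_eq_card h.1
  have h2 : ((margEdges G (X \ Y) Y).card : ℚ) + (innerEdges G Y).card =
      (innerEdges G X).card := by
    exact_mod_cast card_margEdges_sdiff G h.1
  have h3 : ((X \ Y).card : ℚ) ≠ 0 := by
    exact_mod_cast (card_pos.2 (sdiff_nonempty.2 h.2)).ne'
  rw [← h1, ← h2, add_sub_cancel_right, add_sub_cancel_right, outDensity,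
    div_mul_cancel₀ _ h3]

theorem LocallyDense.outDensity_lt [Fintype V] [DecidableEq V] {G : SimpleGraph V}
    [DecidableRel G.Adj] {X W Y : Finset V} (hW : LocallyDense G W) (hX : X ⊂ W) (hY : W ⊂ Y) :
    outDensity G Y W < outDensity G W X := by
  by_contra! hle
  refine hW ⟨W \ X, Y \ W, sdiff_nonempty.2 hX.2, sdiff_nonempty.2 hY.2, sdiff_subset,
    sdiff_inter_self _ _, ?_⟩
  rwa [Finset.sdiff_sdiff_eq_self hX.1, outDensity_sdiff, outDensity_sdiff]

theorem outDensity_add_le_of_lt [Fintype V] [DecidableEq V] {G : SimpleGraph V}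
    [DecidableRel G.Adj] {X Y X' Y' : Finset V} (h : Y ⊂ X) (h' : Y' ⊂ X')
    (hlt : outDensity G X Y < outDensity G X' Y') :
    outDensity G X Y + 1 / (Fintype.card V : ℚ) ^ 2 ≤ outDensity G X' Y' := by
  have ha : (0 : ℚ) < (X \ Y).card := by exact_mod_cast card_pos.2 (sdiff_nonempty.2 h.2)
  have hb : (0 : ℚ) < (X' \ Y').card := by exact_mod_cast card_pos.2 (sdiff_nonempty.2 h'.2)
  have han : ((X \ Y).card : ℚ) ≤ Fintype.card V := by exact_mod_cast card_le_univ _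
  have hbn : ((X' \ Y').card : ℚ) ≤ Fintype.card V := by exact_mod_cast card_le_univ _
  unfold outDensity at *
  have hint : ((margEdges G (X \ Y) Y).card : ℚ) * (X' \ Y').card + 1 ≤
      (margEdges G (X' \ Y') Y').card * (X \ Y).card := by
    rw [div_lt_div_iff₀ ha hb] at hlt
    exact_mod_cast hlt
  have hn : 1 / (Fintype.card V : ℚ) ^ 2 ≤ 1 / ((X \ Y).card * (X' \ Y').card) := by
    apply one_div_le_one_div_of_le (by positivity)
    rw [sq]
    gcongr
  calc _ ≤ ((margEdges G (X \ Y) Y).card : ℚ) / (X \ Y).card +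
        1 / ((X \ Y).card * (X' \ Y').card) := by gcongr
    _ = ((margEdges G (X \ Y) Y).card * (X' \ Y').card + 1) /
        ((X \ Y).card * (X' \ Y').card) := by field_simp
    _ ≤ _ := by
      rw [div_le_div_iff₀ (by positivity) hb]
      nlinarith

theorem LocallyDense.outDensity_lt_left [Fintype V] [DecidableEq V] {G : SimpleGraph V}
    [DecidableRel G.Adj] {X W Y : Finset V} (hW : LocallyDense G W) (hX : X ⊂ W) (hY : W ⊂ Y) :
    outDensity G Y X < outDensity G W X := by
  have hlt := hW.outDensity_lt hX hY
  have e1 := outDensity_mul_card_sub G hX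
  have e2 := outDensity_mul_card_sub G hY
  have e3 := outDensity_mul_card_sub G (hX.trans hY)
  have c1 : (X.card : ℚ) < W.card := by exact_mod_cast card_lt_card hX
  have c2 : (W.card : ℚ) < Y.card := by exact_mod_cast card_lt_card hY
  by_contra! hle
  have m1 := mul_le_mul_of_nonneg_right hle (sub_pos.2 (c1.trans c2)).le
  have m2 := mul_lt_mul_of_pos_right hlt (sub_pos.2 c2)
  linarith

theorem search_step [Fintype V] [DecidableEq V] (G : SimpleGraph V) [DecidableRel G.Adj]
    (k : ℕ) (B : ℕ → Finset V)
    (hchain : ∀ i j, i < j → j ≤ k → B i ⊂ B j)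
    (hall : ∀ W : Finset V, LocallyDense G W ↔ ∃ i ≤ k, W = B i)
    (hB0 : B 0 = ∅) (hBk : B k = Finset.univ)
    (x y z : ℕ) (hxy : x < y) (hyk : y ≤ k) (hzk : z ≤ k)
    (α : ℚ) (hα : α = outDensity G (B y) (B x) + 1 / ((Fintype.card V : ℚ)) ^ 2)
    (hzmax : ∀ W : Finset V,
      ((innerEdges G W).card : ℚ) - α * W.card
        ≤ ((innerEdges G (B z)).card : ℚ) - α * (B z).card)
    (hzbig : ∀ W : Finset V,
      ((innerEdges G W).card : ℚ) - α * W.card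
        = ((innerEdges G (B z)).card : ℚ) - α * (B z).card → W ⊆ B z) :
    (x + 1 < y → x < z ∧ z < y) ∧ (y = x + 1 → z = x) := by
  have hdense : ∀ i ≤ k, LocallyDense G (B i) := fun i hi => (hall _).2 ⟨i, hi, rfl⟩
  have hpos : (0 : ℚ) < 1 / (Fintype.card V : ℚ) ^ 2 := by
    have : 0 < Fintype.card V :=
      (card_pos.2 (sdiff_nonempty.2 (hchain x y hxy hyk).2)).trans_le (card_le_univ _)
    positivity
  have below : ∀ i < z, α ≤ outDensity G (B z) (B i) := by
    intro i hi
    have e := outDensity_mul_card_sub G (hchain i z hi hzk)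
    have c : ((B i).card : ℚ) < (B z).card := by
      exact_mod_cast card_lt_card (hchain i z hi hzk)
    refine le_of_mul_le_mul_right ?_ (sub_pos.2 c)
    linarith [hzmax (B i)]
  have above : ∀ i, z < i → i ≤ k → outDensity G (B i) (B z) < α := by
    intro i hi hik
    by_contra! hle
    have hs := hchain z i hi hik
    have e := outDensity_mul_card_sub G hs
    have c : ((B z).card : ℚ) < (B i).card := by exact_mod_cast card_lt_card hs
    have m := mul_le_mul_of_nonneg_right hle (sub_pos.2 c).le
    exact hs.2 (hzbig (B i) (le_antisymm (hzmax _) (by linarith)))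
  have hzy : z < y := by
    by_contra! hle
    have h1 := below x (hxy.trans_le hle)
    rcases hle.eq_or_lt with rfl | hlt
    · linarith
    · linarith [(hdense y hyk).outDensity_lt_left (hchain x y hxy hyk) (hchain y z hlt hzk)]
  have hxk : x < k := hxy.trans_le hyk
  refine ⟨fun h => ⟨?_, hzy⟩, ?_⟩
  · by_contra! hle
    have hs := hchain x (x + 1) x.lt_succ_self hxk
    have h1 : α ≤ outDensity G (B (x + 1)) (B x) := hα ▸ outDensity_add_le_of_lt
      (hchain x y hxy hyk) hs ((hdense _ hxk).outDensity_lt_left hs (hchain _ y h hyk))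
    rcases hle.eq_or_lt with rfl | hlt
    · exact (above _ z.lt_succ_self hxk).not_ge h1
    · linarith [above x hlt hxk.le, (hdense x hxk.le).outDensity_lt (hchain z x hlt hxk.le) hs]
  · rintro rfl
    by_contra hne
    have hlt : z < x := by omega
    have hs := hchain x (x + 1) hxy hyk
    have hs' := hchain z x hlt hxk.le
    exact (above x hlt hxk.le).not_ge
      (hα ▸ outDensity_add_le_of_lt hs hs' ((hdense x hxk.le).outDensity_lt hs' hs))
end

section
/- Profile 2-approximation of the greedy decomposition: let B = (∅ = B_0 ⊊ ⋯ ⊊ B_k = V) be the optimal locally-dense decomposition and C = (∅ = C_0 ⊊ ⋯ ⊊ C_l = V) the chain produced by the greedy peeling algorithm GreedyLD. Then for every index i with 1 ≤ i ≤ |V|, prof(i; C) ≥ prof(i; B)/2. -/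
open Finset

variable {V : Type*}

/-- `{v 0, …, v (j-1)}`, the prefix of length `j` of the (reversed) peeling order. -/
def prefixSet [DecidableEq V] (v : ℕ → V) (j : ℕ) : Finset V := (Finset.range j).image v

/-- `v` lists the vertices in reverse removal order of a min-degree peeling:
the last vertex of each prefix has minimum degree within that prefix. -/
def IsPeelingOrder [Fintype V] [DecidableEq V] (G : SimpleGraph V) [DecidableRel G.Adj]
    (v : ℕ → V) : Prop :=
  (∀ i j, i < Fintype.card V → j < Fintype.card V → v i = v j → i = j) ∧
  prefixSet v (Fintype.card V) = Finset.univ ∧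
  ∀ j, 1 ≤ j → j ≤ Fintype.card V → ∀ u ∈ prefixSet v j,
    degIn G (v (j - 1)) (prefixSet v j) ≤ degIn G u (prefixSet v j)

theorem degIn_mono [DecidableEq V] (G : SimpleGraph V) [DecidableRel G.Adj] (x : V)
    {S T : Finset V} (h : S ⊆ T) : degIn G x S ≤ degIn G x T :=
  Finset.card_le_card (Finset.filter_subset_filter _ h)

section Profile

variable [Fintype V] [DecidableEq V] (G : SimpleGraph V) [DecidableRel G.Adj]

theorem card_margEdges_sdiff_add (X Y : Finset V) :
    (margEdges G (X \ Y) Y).card + (innerEdges G Y).card = (innerEdges G (X ∪ Y)).card := by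
  have hd : Disjoint (margEdges G (X \ Y) Y) (innerEdges G Y) := by
    rw [Finset.disjoint_left]
    intro e he he'
    simp only [margEdges, innerEdges, Finset.mem_filter, Finset.mem_sdiff] at he he'
    obtain ⟨_, _, u, hu, _, huY⟩ := he
    exact huY (he'.2 u hu)
  rw [← Finset.card_union_of_disjoint hd]
  congr 1
  ext e
  simp only [margEdges, innerEdges, Finset.mem_union, Finset.mem_filter, Finset.mem_sdiff]
  grind

/-- The Lagrangian `|E(S)| - β |S|` of the densest-subgraph problem. -/
def edgeExcess (β : ℚ) (S : Finset V) : ℚ :=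
  (innerEdges G S).card - β * S.card

variable {G}

theorem edgeExcess_union_sub (β : ℚ) {X Y : Finset V} (h : (X \ Y).Nonempty) :
    edgeExcess G β (X ∪ Y) - edgeExcess G β Y = (outDensity G X Y - β) * (X \ Y).card := by
  have h0 : ((X \ Y).card : ℚ) ≠ 0 := by exact_mod_cast h.card_pos.ne'
  have h1 : ((margEdges G (X \ Y) Y).card : ℚ) + (innerEdges G Y).card
      = (innerEdges G (X ∪ Y)).card := by exact_mod_cast card_margEdges_sdiff_add G X Y
  have h2 : ((X \ Y).card : ℚ) + Y.card = (X ∪ Y).card := by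
    exact_mod_cast Finset.card_sdiff_add_card X Y
  have h3 : outDensity G X Y * (X \ Y).card = (margEdges G (X \ Y) Y).card :=
    div_mul_cancel₀ _ h0
  rw [sub_mul, h3, edgeExcess, edgeExcess, ← h1, ← h2]
  ring

theorem le_outDensity_iff (β : ℚ) {X Y : Finset V} (h : (X \ Y).Nonempty) :
    β ≤ outDensity G X Y ↔ edgeExcess G β Y ≤ edgeExcess G β (X ∪ Y) := by
  have h0 : (0 : ℚ) < (X \ Y).card := by exact_mod_cast h.card_pos
  rw [← sub_nonneg, ← mul_nonneg_iff_of_pos_right h0, ← edgeExcess_union_sub β h, sub_nonneg]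

/-- Of the maximizers of `edgeExcess G β`, one of largest cardinality is locally dense. -/
theorem exists_locallyDense_isMax_edgeExcess (G : SimpleGraph V) [DecidableRel G.Adj] (β : ℚ) :
    ∃ W : Finset V, LocallyDense G W ∧ (∀ S, edgeExcess G β S ≤ edgeExcess G β W) ∧
      ∀ S, edgeExcess G β S = edgeExcess G β W → S.card ≤ W.card := by
  obtain ⟨M, -, hM⟩ := (Finset.univ : Finset (Finset V)).exists_max_image
    (edgeExcess G β) Finset.univ_nonempty
  obtain ⟨W, hW, hWc⟩ := ((Finset.univ : Finset (Finset V)).filter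
    (fun S => edgeExcess G β S = edgeExcess G β M)).exists_max_image Finset.card ⟨M, by simp⟩
  simp only [Finset.mem_filter, Finset.mem_univ, true_and, forall_const] at hM hW hWc
  refine ⟨W, ?_, fun S => hW ▸ hM S, fun S hS => hWc S (hS.trans hW)⟩
  rintro ⟨X, Y, hX, hY, hXW, hYW, hle⟩
  have hX' : X \ (W \ X) = X := by grind
  have hXu : X ∪ W \ X = W := Finset.union_sdiff_of_subset hXW
  have hY' : Y \ W = Y :=
    Finset.sdiff_eq_self_iff_disjoint.2 (Finset.disjoint_iff_inter_eq_empty.2 hYW)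
  have h1 : β ≤ outDensity G X (W \ X) := by
    rw [le_outDensity_iff β (by rwa [hX']), hXu, hW]
    exact hM _
  have h2 := (le_outDensity_iff β (by rwa [hY'])).1 (h1.trans hle)
  have h3 := hWc (Y ∪ W) (le_antisymm (hM _) (hW ▸ h2))
  have h4 := Finset.card_sdiff_add_card Y W
  have h5 := hY.card_pos
  rw [hY'] at h4
  omega

theorem LocallyDense.outDensity_lt_s14 {A W C : Finset V} (hW : LocallyDense G W)
    (hA : A ⊂ W) (hC : W ⊂ C) : outDensity G C W < outDensity G W A := by
  by_contra! hle
  refine hW ⟨W \ A, C \ W, Finset.sdiff_nonempty.2 hA.2, Finset.sdiff_nonempty.2 hC.2,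
    Finset.sdiff_subset, Finset.sdiff_inter_self _ _, ?_⟩
  rw [Finset.sdiff_sdiff_eq_self hA.1]
  simpa [outDensity] using hle

theorem card_margEdges_filter_mem {X : Finset V} (Y : Finset V) {x : V} (hx : x ∈ X) :
    ((margEdges G X Y).filter (x ∈ ·)).card = degIn G x (X ∪ Y) := by
  rw [degIn, ← Finset.card_image_of_injective _ (Sym2.mkEmbedding x).injective]
  congr 1
  ext e
  induction e with
  | _ a b =>
    simp only [margEdges, Finset.mem_filter, Finset.mem_image, SimpleGraph.mem_edgeFinset,
      SimpleGraph.mem_edgeSet, Sym2.mem_iff, Sym2.mkEmbedding_apply, Sym2.eq_iff]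
    grind [SimpleGraph.adj_comm]

theorem sum_degIn_le_two_mul_card_margEdges (X Y : Finset V) :
    ∑ x ∈ X, degIn G x (X ∪ Y) ≤ 2 * (margEdges G X Y).card := by
  rw [← Finset.sum_congr rfl fun x hx => card_margEdges_filter_mem Y hx]
  have h := Finset.sum_card_bipartiteAbove_eq_sum_card_bipartiteBelow (s := X)
    (t := margEdges G X Y) (fun x e => x ∈ e)
  simp only [Finset.bipartiteAbove, Finset.bipartiteBelow] at h
  rw [h, mul_comm]
  refine Finset.sum_le_card_nsmul _ _ 2 fun e _ => ?_
  induction e with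
  | _ a b =>
    refine (Finset.card_le_card (t := {a, b}) fun y hy => ?_).trans Finset.card_le_two
    simpa using (Finset.mem_filter.1 hy).2

theorem half_le_outDensity {β : ℚ} {P Q : Finset V} (hQP : Q ⊂ P)
    (h : ∀ x ∈ P, β ≤ degIn G x P) : β / 2 ≤ outDensity G P Q := by
  have h0 : (0 : ℚ) < (P \ Q).card := by
    exact_mod_cast (Finset.sdiff_nonempty.2 hQP.2).card_pos
  have h1 := sum_degIn_le_two_mul_card_margEdges (G := G) (P \ Q) Q
  rw [Finset.sdiff_union_of_subset hQP.1] at h1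
  have h2 : (∑ x ∈ P \ Q, (degIn G x P : ℚ)) ≤ 2 * (margEdges G (P \ Q) Q).card := by
    exact_mod_cast h1
  have h3 : ((P \ Q).card : ℚ) * β ≤ ∑ x ∈ P \ Q, (degIn G x P : ℚ) := by
    rw [← nsmul_eq_mul]
    exact Finset.card_nsmul_le_sum _ _ _ fun x hx => h x (Finset.mem_sdiff.1 hx).1
  rw [outDensity, le_div_iff₀ h0]
  linarith

theorem outDensity_singleton_erase {W : Finset V} {x : V} (hx : x ∈ W) :
    outDensity G {x} (W.erase x) = degIn G x W := by
  have h1 : ({x} : Finset V) \ W.erase x = {x} := by grind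
  have h2 : {x} ∪ W.erase x = W := by grind
  have h3 := card_margEdges_filter_mem (G := G) (W.erase x) (Finset.mem_singleton_self x)
  rw [h2, Finset.filter_true_of_mem] at h3
  · simp [outDensity, h1, h3]
  · intro e he
    simpa [margEdges] using (Finset.mem_filter.1 he).2.2

/-- Vertices of a member of the locally-dense decomposition have at least its profile density
as their degree in that member. -/
theorem outDensity_le_degIn_of_chain {k : ℕ} {B : ℕ → Finset V}
    (hBchain : ∀ i j, i < j → j ≤ k → B i ⊂ B j)
    (hBall : ∀ W : Finset V, LocallyDense G W ↔ ∃ i ≤ k, W = B i)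
    {j : ℕ} (hj : j + 1 ≤ k) {x : V} (hx : x ∈ B (j + 1)) :
    outDensity G (B (j + 1)) (B j) ≤ degIn G x (B (j + 1)) := by
  set β := outDensity G (B (j + 1)) (B j) with hβ
  have hne {a b : ℕ} (hab : a < b) (hb : b ≤ k) : (B b \ B a).Nonempty :=
    Finset.sdiff_nonempty.2 (hBchain a b hab hb).2
  have hun {a b : ℕ} (hab : a < b) (hb : b ≤ k) : B b ∪ B a = B b :=
    Finset.union_eq_left.2 (hBchain a b hab hb).1
  have hLD {a : ℕ} (ha : a ≤ k) : LocallyDense G (B a) := (hBall _).2 ⟨a, ha, rfl⟩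
  have hstep : edgeExcess G β (B (j + 1)) = edgeExcess G β (B j) := by
    have h := edgeExcess_union_sub (G := G) β (hne (Nat.lt_succ_self j) hj)
    rw [hun (Nat.lt_succ_self j) hj, ← hβ, sub_self, zero_mul] at h
    linarith
  obtain ⟨W, hWd, hWmax, hWcard⟩ := exists_locallyDense_isMax_edgeExcess G β
  obtain ⟨i, hik, rfl⟩ := (hBall W).1 hWd
  have hij : i = j + 1 := by
    rcases lt_trichotomy i (j + 1) with h | h | h
    · exfalso
      rcases Nat.lt_or_eq_of_le (Nat.lt_succ_iff.1 h) with h' | rfl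
      · have hlt := (hLD (by omega : j ≤ k)).outDensity_lt_s14 (hBchain i j h' (by omega))
          (hBchain j (j + 1) (by omega) hj)
        rw [← hβ] at hlt
        have heq := edgeExcess_union_sub (G := G) β (hne h' (by omega))
        have hpos : (0 : ℚ) < (B j \ B i).card := by
          exact_mod_cast (hne h' (by omega)).card_pos
        have := mul_pos (sub_pos.2 hlt) hpos
        have := hWmax (B j ∪ B i)
        linarith
      · have := Finset.card_lt_card (hBchain i (i + 1) h hj)
        have := hWcard _ hstep
        omega
    · exact h
    · exfalso
      have hlt := (hLD hj).outDensity_lt_s14 (hBchain j (j + 1) (by omega) hj) (hBchain _ i h hik)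
      have := (le_outDensity_iff (G := G) β (hne h hik)).2 (by rw [hun h hik]; exact hWmax _)
      linarith
  subst hij
  have h1 : ({x} : Finset V) \ (B (j + 1)).erase x = {x} := by grind
  have h2 : {x} ∪ (B (j + 1)).erase x = B (j + 1) := by grind
  rw [← outDensity_singleton_erase hx, le_outDensity_iff β (by simp [h1]), h2]
  exact hWmax _

/-- If every vertex of `S` has degree at least `β` within `S`, then some prefix of a peeling order
contains `S` and has all its inner degrees at least `β`. -/
theorem IsPeelingOrder.exists_prefixSet {v : ℕ → V} (hv : IsPeelingOrder G v) {β : ℚ}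
    {S : Finset V} (hS : S.Nonempty) (hβ : ∀ x ∈ S, β ≤ degIn G x S) :
    ∃ p ≤ Fintype.card V, S ⊆ prefixSet v p ∧
      ∀ x ∈ prefixSet v p, β ≤ degIn G x (prefixSet v p) := by
  have hex : ∃ p, S ⊆ prefixSet v p := ⟨Fintype.card V, by rw [hv.2.1]; exact S.subset_univ⟩
  have hsub := Nat.find_spec hex
  have hle : Nat.find hex ≤ Fintype.card V :=
    Nat.find_min' hex (by rw [hv.2.1]; exact S.subset_univ)
  have hmin := fun q => Nat.find_min hex (m := q)
  generalize Nat.find hex = p at hsub hle hmin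
  obtain _ | p := p
  · simp [prefixSet, hS.ne_empty] at hsub
  have hlast : v p ∈ S := by
    by_contra hn
    refine hmin p (Nat.lt_succ_self p) fun y hy => ?_
    have := hsub hy
    simp only [prefixSet, Finset.range_add_one, Finset.image_insert, Finset.mem_insert] at this
    rcases this with rfl | h
    · exact absurd hy hn
    · exact h
  refine ⟨p + 1, hle, hsub, fun x hx => (hβ _ hlast).trans ?_⟩
  exact_mod_cast (degIn_mono G _ hsub).trans (hv.2.2 (p + 1) (by omega) hle x hx)

theorem IsPeelingOrder.card_prefixSet {v : ℕ → V} (hv : IsPeelingOrder G v) {p : ℕ}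
    (hp : p ≤ Fintype.card V) : (prefixSet v p).card = p := by
  rw [prefixSet, Finset.card_image_of_injOn, Finset.card_range]
  intro a ha b hb hab
  simp only [Finset.coe_range, Set.mem_Iio] at ha hb
  exact hv.1 a b (by omega) (by omega) hab

end Profile

theorem greedy_profile_two_approx [Fintype V] [DecidableEq V] (G : SimpleGraph V) [DecidableRel G.Adj]
    (n : ℕ) (hn : n = Fintype.card V)
    (k : ℕ) (B : ℕ → Finset V) (hB0 : B 0 = ∅) (hBk : B k = Finset.univ)
    (hBchain : ∀ i j, i < j → j ≤ k → B i ⊂ B j)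
    (hBall : ∀ W : Finset V, LocallyDense G W ↔ ∃ i ≤ k, W = B i)
    (v : ℕ → V) (hpeel : IsPeelingOrder G v)
    (l : ℕ) (m : ℕ → ℕ) (hm0 : m 0 = 0) (hml : m l = n)
    (hmmono : ∀ s t, s < t → t ≤ l → m s < m t)
    (hopt : ∀ t, 1 ≤ t → t ≤ l → ∀ i, m (t - 1) < i → i ≤ n →
      outDensity G (prefixSet v i) (prefixSet v (m (t - 1)))
        ≤ outDensity G (prefixSet v (m t)) (prefixSet v (m (t - 1))))
    (i : ℕ) (hi1 : 1 ≤ i) (hin : i ≤ n)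
    (jB : ℕ) (hjB1 : i ≤ (B jB).card) (hjB2 : ∀ x < jB, (B x).card < i)
    (jC : ℕ) (hjC1 : i ≤ (prefixSet v (m jC)).card)
    (hjC2 : ∀ x < jC, (prefixSet v (m x)).card < i) :
    outDensity G (B jB) (B (jB - 1)) / 2
      ≤ outDensity G (prefixSet v (m jC)) (prefixSet v (m (jC - 1))) := by
  have hjBk : jB ≤ k := by
    by_contra! h
    have := hjB2 k h
    rw [hBk, Finset.card_univ] at this
    omega
  have hjCl : jC ≤ l := by
    by_contra! h
    have := hjC2 l h
    rw [hml, hpeel.card_prefixSet hn.le] at this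
    omega
  obtain _ | b := jB
  · simp [hB0] at hjB1
    omega
  obtain _ | c := jC
  · simp [hm0, prefixSet] at hjC1
    omega
  simp only [Nat.add_sub_cancel]
  have hmc : m c ≤ n := hml ▸ (hmmono c l (by omega) le_rfl).le
  have hmci := hjC2 c (Nat.lt_succ_self c)
  rw [hpeel.card_prefixSet (hn ▸ hmc)] at hmci
  obtain ⟨p, hpn, hsub, hdeg⟩ := hpeel.exists_prefixSet
    (Finset.card_pos.1 (by omega : 0 < (B (b + 1)).card))
    (fun x hx => outDensity_le_degIn_of_chain hBchain hBall hjBk hx)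
  have hip := hjB1.trans (Finset.card_le_card hsub)
  rw [hpeel.card_prefixSet hpn] at hip
  have hQP : prefixSet v (m c) ⊂ prefixSet v p := by
    refine (Finset.ssubset_iff_subset_ne).2 ⟨Finset.image_subset_image
      (Finset.range_subset_range.2 (by omega)), fun h => ?_⟩
    have := congrArg Finset.card h
    rw [hpeel.card_prefixSet (hn ▸ hmc), hpeel.card_prefixSet hpn] at this
    omega
  exact (half_le_outDensity hQP hdeg).trans
    (hopt (c + 1) (by omega) hjCl p (by simpa using by omega) (by omega))
end
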